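/- arXiv:2204.11459 — 2 statements merged into one kernel-verified Lean document; each statement's English description precedes it below -/
import Mathlib

section
/- Let P and P' be two finite measurable partitions of I = [0,1] with Lebesgue measure m. Then there exists φ ∈ Aut(I,m) (an invertible m-preserving transformation) such that the partitions P and φ⁻¹P' are independent with respect to m, i.e. m(E ∩ φ⁻¹E') = m(E)·m(E') for all E ∈ P, E' ∈ P'. -/
open MeasureTheory Set

/-- The unit interval as a subtype of `ℝ`, with Lebesgue measure. -/
local notation "I" => (Icc (0:ℝ) 1)

theorem volume_cantorSet : volume cantorSet = 0 := by
  have hfin : volume cantorSet ≠ ⊤ :=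
    measure_ne_top_of_subset cantorSet_subset_unitInterval (by simp)
  have himage (a : ℝ) :
      volume ((fun x ↦ (a + x) / 3) '' cantorSet) = ENNReal.ofReal (1 / 3) * volume cantorSet := by
    have : (fun x : ℝ ↦ (a + x) / 3) '' cantorSet
        = AffineMap.homothety (a / 2) (1 / 3 : ℝ) '' cantorSet := by
      refine image_congr fun x _ ↦ ?_
      simp only [AffineMap.homothety_apply, vsub_eq_sub, smul_eq_mul, vadd_eq_add]
      ring
    rw [this, Measure.addHaar_image_homothety]
    norm_num [abs_of_pos]
  have hle : volume cantorSet ≤ ENNReal.ofReal (2 / 3) * volume cantorSet := by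
    calc volume cantorSet
        = volume ((· / 3) '' cantorSet ∪ (fun x ↦ (2 + x) / 3) '' cantorSet) := by
          rw [← cantorSet_eq_union_halves]
      _ ≤ volume ((fun x ↦ (0 + x) / 3) '' cantorSet)
          + volume ((fun x ↦ (2 + x) / 3) '' cantorSet) := by
          simpa only [zero_add] using measure_union_le _ _
      _ = ENNReal.ofReal (2 / 3) * volume cantorSet := by
          rw [himage, himage, ← add_mul, ← ENNReal.ofReal_add (by norm_num) (by norm_num)]
          norm_num
  have hreal := ENNReal.toReal_mono (ENNReal.mul_ne_top ENNReal.ofReal_ne_top hfin) hle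
  rw [ENNReal.toReal_mul, ENNReal.toReal_ofReal (by norm_num)] at hreal
  have h0 : (volume cantorSet).toReal = 0 :=
    le_antisymm (by linarith) ENNReal.toReal_nonneg
  exact (ENNReal.toReal_eq_zero_iff _).1 h0 |>.resolve_right hfin

theorem not_countable_cantorSet : ¬ cantorSet.Countable := fun h ↦
  absurd ((cantorSetEquivNatToBool.countable_iff).1 h) <| by
    rw [← Cardinal.mk_le_aleph0_iff]
    simp [Cardinal.aleph0_lt_continuum]

theorem exists_uncountable_null_set_unitInterval :
    ∃ C : Set I, MeasurableSet C ∧ ¬ C.Countable ∧ volume C = 0 := by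
  refine ⟨Subtype.val ⁻¹' cantorSet, measurable_subtype_coe isClosed_cantorSet.measurableSet,
    fun h ↦ not_countable_cantorSet ?_, ?_⟩
  · have := h.image Subtype.val
    rwa [Subtype.image_preimage_coe, inter_eq_right.2 cantorSet_subset_unitInterval] at this
  · rw [← volume_image_subtype_coe measurableSet_Icc, Subtype.image_preimage_coe]
    exact measure_mono_null inter_subset_right volume_cantorSet

/-- A measurable map that is injective on a measurable set whose complement and whose image's
complement are uncountable agrees on that set with a measurable equivalence. -/
theorem exists_measurableEquiv_eqOn {X Y : Type*} [MeasurableSpace X] [StandardBorelSpace X]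
    [MeasurableSpace Y] [StandardBorelSpace Y] {T : X → Y} (hT : Measurable T) {A : Set X}
    (hA : MeasurableSet A) (hinj : InjOn T A) (hc : ¬ Aᶜ.Countable) (hc' : ¬ (T '' A)ᶜ.Countable) :
    ∃ e : X ≃ᵐ Y, EqOn e T A := by
  classical
  have hTA : MeasurableSet (T '' A) := hA.image_of_measurable_injOn hT hinj
  have := hA.standardBorel
  have := hA.compl.standardBorel
  have := hTA.compl.standardBorel
  let g : (Aᶜ : Set X) ≃ᵐ ((T '' A)ᶜ : Set Y) :=
    PolishSpace.measurableEquivOfNotCountable hc hc'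
  let f : X → Y := fun x ↦ if h : x ∈ A then T x else g ⟨x, h⟩
  have hfA {x : X} (h : x ∈ A) : f x = T x := dif_pos h
  have hfc {x : X} (h : x ∉ A) : f x = g ⟨x, h⟩ := dif_neg h
  have hmem {x : X} : f x ∈ T '' A ↔ x ∈ A := by
    by_cases h : x ∈ A
    · simpa only [hfA h, h, iff_true] using mem_image_of_mem T h
    · simpa only [hfc h, h, iff_false, mem_compl_iff] using (g ⟨x, h⟩).2
  have hfm : Measurable f :=
    Measurable.dite (hT.comp measurable_subtype_coe)
      (measurable_subtype_coe.comp g.measurable) hA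
  have hfi : Function.Injective f := by
    intro x y hxy
    have hiff : x ∈ A ↔ y ∈ A := by rw [← hmem, hxy, hmem]
    by_cases h : x ∈ A
    · have h' := hiff.1 h
      rw [hfA h, hfA h'] at hxy
      exact hinj h h' hxy
    · have h' := mt hiff.2 h
      rw [hfc h, hfc h'] at hxy
      exact congrArg Subtype.val (g.injective (Subtype.ext hxy))
  have hfs : Function.Surjective f := by
    intro y
    by_cases h : y ∈ T '' A
    · obtain ⟨x, hx, rfl⟩ := h
      exact ⟨x, hfA hx⟩
    · refine ⟨g.symm ⟨y, h⟩, (hfc (g.symm ⟨y, h⟩).2).trans ?_⟩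
      exact congrArg Subtype.val (g.apply_symm_apply ⟨y, h⟩)
  refine ⟨⟨Equiv.ofBijective f ⟨hfi, hfs⟩, hfm, fun s hs ↦ ?_⟩, fun x hx ↦ hfA hx⟩
  rw [← Equiv.image_eq_preimage_symm]
  exact (hfm.measurableEmbedding hfi).measurableSet_image' hs

/-- A measure-preserving map between standard Borel spaces that is injective on a conull set
is almost everywhere equal to a measurable equivalence, provided that both spaces contain
uncountable null sets. -/
theorem MeasureTheory.MeasurePreserving.exists_measurableEquiv_ae_eq {X Y : Type*}
    [MeasurableSpace X] [StandardBorelSpace X] [MeasurableSpace Y] [StandardBorelSpace Y]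
    {μ : Measure X} {ν : Measure Y} {T : X → Y} (hT : MeasurePreserving T μ ν)
    {A : Set X} (hA : MeasurableSet A) (hAc : μ Aᶜ = 0) (hinj : InjOn T A)
    {C : Set X} (hC : MeasurableSet C) (hCc : ¬ C.Countable) (hC0 : μ C = 0)
    {C' : Set Y} (hC' : MeasurableSet C') (hCc' : ¬ C'.Countable) (hC0' : ν C' = 0) :
    ∃ e : X ≃ᵐ Y, e =ᵐ[μ] T := by
  set B : Set X := A \ (C ∪ T ⁻¹' C') with hB
  have hBm : MeasurableSet B := hA.diff (hC.union (hT.measurable hC'))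
  obtain ⟨e, he⟩ := exists_measurableEquiv_eqOn hT.measurable hBm (hinj.mono sdiff_subset)
    (fun h ↦ hCc (h.mono (by intro x hx hxB; exact hxB.2 (Or.inl hx))))
    (fun h ↦ hCc' (h.mono (by rintro y hy ⟨x, hx, rfl⟩; exact hx.2 (Or.inr hy))))
  refine ⟨e, ?_⟩
  have hBc : μ Bᶜ = 0 := by
    rw [hB, sdiff_eq, compl_inter, compl_compl]
    exact measure_union_null hAc (measure_union_null hC0
      (by rw [hT.measure_preimage hC'.nullMeasurableSet, hC0']))
  filter_upwards [measure_eq_zero_iff_ae_notMem.1 hBc] with x hx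
  exact he (not_not.1 hx)

/-- The distribution function of a (sub)probability measure on the unit interval, with values in
the unit interval. -/
noncomputable def unitIntervalCDF (μ : Measure I) [IsZeroOrProbabilityMeasure μ] (x : I) : I :=
  ⟨μ.real (Iic x), measureReal_nonneg, measureReal_le_one⟩

theorem monotone_unitIntervalCDF (μ : Measure I) [IsZeroOrProbabilityMeasure μ] :
    Monotone (unitIntervalCDF μ) := fun _ _ h ↦
  Subtype.coe_le_coe.1 (measureReal_mono (Iic_subset_Iic.2 h))

theorem continuous_unitIntervalCDF (μ : Measure I) [IsProbabilityMeasure μ]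
    [NullSingletonClass μ] : Continuous (unitIntervalCDF μ) := by
  have : IsProbabilityMeasure (μ.map Subtype.val) :=
    Measure.isProbabilityMeasure_map (by fun_prop)
  have hcont : Continuous (ProbabilityTheory.cdf (μ.map Subtype.val)) := by
    refine continuous_iff_continuousAt.2 fun x ↦ ?_
    set f := ProbabilityTheory.cdf (μ.map Subtype.val) with hf
    rw [f.mono.continuousAt_iff_leftLim_eq_rightLim, f.rightLim_eq]
    refine le_antisymm (f.mono.leftLim_le le_rfl) ?_
    have hx : f.measure {x} = 0 := by
      rw [hf, ProbabilityTheory.measure_cdf,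
        Measure.map_apply measurable_subtype_coe (measurableSet_singleton x)]
      exact (Set.Countable.preimage_of_injOn (countable_singleton x)
        Subtype.val_injective.injOn).measure_zero μ
    rw [StieltjesFunction.measure_singleton, ENNReal.ofReal_eq_zero] at hx
    linarith
  refine Continuous.subtype_mk ?_ _
  have : (fun x : I ↦ μ.real (Iic x))
      = fun x : I ↦ ProbabilityTheory.cdf (μ.map Subtype.val) x := by
    funext x
    rw [ProbabilityTheory.cdf_eq_real,
      map_measureReal_apply measurable_subtype_coe measurableSet_Iic]
    rfl
  rw [this]
  exact hcont.comp continuous_subtype_val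

theorem measurePreserving_unitIntervalCDF (μ : Measure I) [IsProbabilityMeasure μ]
    [NullSingletonClass μ] : MeasurePreserving (unitIntervalCDF μ) μ volume := by
  have hmono := monotone_unitIntervalCDF μ
  have hcont := continuous_unitIntervalCDF μ
  have hzero : unitIntervalCDF μ 0 = 0 := by
    refine Subtype.ext ?_
    have : Iic (0 : I) = {0} := Iic_bot
    simp [unitIntervalCDF, this, measureReal_def]
  have hone : unitIntervalCDF μ 1 = 1 := by
    refine Subtype.ext ?_
    have : Iic (1 : I) = univ := Iic_top
    simp [unitIntervalCDF, this]
  refine ⟨hmono.measurable, ?_⟩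
  have : IsProbabilityMeasure (μ.map (unitIntervalCDF μ)) :=
    Measure.isProbabilityMeasure_map hmono.measurable.aemeasurable
  refine Measure.ext_of_Iic _ _ fun t ↦ ?_
  rw [Measure.map_apply hmono.measurable measurableSet_Iic, unitInterval.volume_Iic]
  obtain ⟨s, hs, hmax⟩ := (isClosed_Iic.preimage hcont).isCompact.exists_isGreatest
    (s := unitIntervalCDF μ ⁻¹' Iic t) ⟨0, by simp [hzero]⟩
  obtain ⟨r, -, hr⟩ : t ∈ unitIntervalCDF μ '' Icc 0 1 :=
    intermediate_value_Icc zero_le_one hcont.continuousOn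
      (by rw [hzero, hone]; exact ⟨t.2.1, t.2.2⟩)
  have hst : unitIntervalCDF μ s = t :=
    le_antisymm hs (hr ▸ hmono (hmax (show r ∈ _ from hr.le)))
  have hpre : unitIntervalCDF μ ⁻¹' Iic t = Iic s :=
    Subset.antisymm hmax fun x hx ↦ (hmono hx).trans hs
  rw [hpre, ← hst]
  exact (ofReal_measureReal).symm

section

variable {ι : Type*} (P : I → ι)

/-- The distribution function of Lebesgue measure conditioned on a cell of a partition. -/
noncomputable def fiberCDF (i : ι) : I → I :=
  unitIntervalCDF (ProbabilityTheory.cond volume (P ⁻¹' {i}))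

theorem monotone_fiberCDF (i : ι) : Monotone (fiberCDF P i) :=
  monotone_unitIntervalCDF _

/-- The map sending `x` to the cell of `x` together with the value at `x` of the distribution
function of Lebesgue measure conditioned on that cell. -/
noncomputable def fiberwiseCDF (x : I) : ι × I :=
  (P x, fiberCDF P (P x) x)

variable {P} [MeasurableSpace ι] [MeasurableSingletonClass ι]

theorem measurable_fiberwiseCDF [Finite ι] (hP : Measurable P) :
    Measurable (fiberwiseCDF P) := by
  have h : Measurable (Function.uncurry (fiberCDF P)) :=
    measurable_from_prod_countable_right fun i ↦ (monotone_fiberCDF P i).measurable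
  have h' : Measurable fun x ↦ Function.uncurry (fiberCDF P) (P x, x) :=
    h.comp (hP.prodMk measurable_id)
  exact hP.prodMk h'

theorem volume_fiber_inter_preimage_fiberCDF (hP : Measurable P) (i : ι) {t : Set I}
    (ht : MeasurableSet t) :
    volume (P ⁻¹' {i} ∩ fiberCDF P i ⁻¹' t) = volume (P ⁻¹' {i}) * volume t := by
  have hPi : MeasurableSet (P ⁻¹' {i}) := hP (measurableSet_singleton i)
  by_cases h0 : volume (P ⁻¹' {i}) = 0
  · rw [h0, zero_mul, measure_inter_null_of_null_left _ h0]
  have := ProbabilityTheory.cond_isProbabilityMeasure h0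
  have : NullSingletonClass (ProbabilityTheory.cond volume (P ⁻¹' {i})) :=
    ⟨fun x ↦ ProbabilityTheory.cond_absolutelyContinuous (measure_singleton x)⟩
  have ht' : ProbabilityTheory.cond volume (P ⁻¹' {i}) (fiberCDF P i ⁻¹' t) = volume t :=
    (measurePreserving_unitIntervalCDF _).measure_preimage ht.nullMeasurableSet
  rw [← ht', mul_comm, ProbabilityTheory.cond_mul_eq_inter hPi]

theorem measurePreserving_fiberwiseCDF [Finite ι] (hP : Measurable P) :
    MeasurePreserving (fiberwiseCDF P) volume ((volume.map P).prod volume) := by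
  have hmeas := measurable_fiberwiseCDF hP
  have : IsProbabilityMeasure ((volume : Measure I).map P) :=
    Measure.isProbabilityMeasure_map hP.aemeasurable
  refine ⟨hmeas, (Measure.prod_eq fun s t hs ht ↦ ?_).symm⟩
  rw [Measure.map_apply hmeas (hs.prod ht), Measure.map_apply hP hs]
  obtain ⟨E, hE⟩ : ∃ E : Set I, ∀ x, x ∈ E ↔ fiberCDF P (P x) x ∈ t :=
    ⟨(fun x ↦ fiberCDF P (P x) x) ⁻¹' t, fun _ ↦ Iff.rfl⟩
  have hfib (i : ι) : MeasurableSet (P ⁻¹' {i}) := hP (measurableSet_singleton i)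
  have hcell (i : ι) : volume (P ⁻¹' {i} ∩ E) = volume (P ⁻¹' {i}) * volume t := by
    rw [← volume_fiber_inter_preimage_fiberCDF hP i ht]
    congr 1
    ext x
    simp only [mem_inter_iff, mem_preimage, mem_singleton_iff, hE]
    exact and_congr_right fun hx ↦ by rw [hx]
  have hsfin := s.toFinite
  have hcoe : (hsfin.toFinset : Set ι) = s := hsfin.coe_toFinset
  calc volume (fiberwiseCDF P ⁻¹' s ×ˢ t)
      = volume (P ⁻¹' s ∩ E) := by
          congr 1
          ext x
          simp only [mem_inter_iff, mem_preimage, mem_prod, hE, fiberwiseCDF]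
    _ = (volume.restrict E) (P ⁻¹' ↑hsfin.toFinset) := by
      rw [hcoe, Measure.restrict_apply (hP hs)]
    _ = ∑ i ∈ hsfin.toFinset, volume (P ⁻¹' {i}) * volume t := by
      rw [← sum_measure_preimage_singleton _ fun i _ ↦ hfib i]
      exact Finset.sum_congr rfl fun i _ ↦ by rw [Measure.restrict_apply (hfib i), hcell]
    _ = volume (P ⁻¹' s) * volume t := by
      rw [← Finset.sum_mul, sum_measure_preimage_singleton _ fun i _ ↦ hfib i, hcoe]

theorem exists_measurableSet_injOn_fiberwiseCDF [Finite ι] (hP : Measurable P) :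
    ∃ A : Set I, MeasurableSet A ∧ volume Aᶜ = 0 ∧ InjOn (fiberwiseCDF P) A := by
  obtain ⟨D, hDc, hDd⟩ := TopologicalSpace.exists_countable_dense I
  have : Countable D := hDc
  -- the values of the distribution functions that are attained more than once are attained in `D`
  set W : Set (ι × I) := range fun p : ι × D ↦ (p.1, fiberCDF P p.1 p.2)
  have hWc : W.Countable := countable_range _
  have hT := measurePreserving_fiberwiseCDF hP
  have : IsProbabilityMeasure ((volume : Measure I).map P) :=
    Measure.isProbabilityMeasure_map hP.aemeasurable
  refine ⟨(fiberwiseCDF P ⁻¹' W)ᶜ, (hT.measurable hWc.measurableSet).compl, ?_, ?_⟩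
  · rw [compl_compl, hT.measure_preimage hWc.measurableSet.nullMeasurableSet]
    exact hWc.measure_zero _
  · have key : ∀ x y : I, x < y → fiberwiseCDF P x = fiberwiseCDF P y →
        fiberwiseCDF P x ∈ W := by
      intro x y hxy h
      obtain ⟨q, hq, hxq, hqy⟩ := hDd.exists_between hxy
      have hPxy : P y = P x := (congrArg Prod.fst h).symm
      have hsnd := congrArg Prod.snd h
      simp only [fiberwiseCDF, hPxy] at hsnd
      refine ⟨(P x, ⟨q, hq⟩), Prod.ext rfl (le_antisymm ?_ ?_)⟩
      · exact (monotone_fiberCDF P _ hqy.le).trans hsnd.ge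
      · exact monotone_fiberCDF P _ hxq.le
    intro x hx y hy h
    rcases lt_trichotomy x y with hlt | heq | hgt
    · exact absurd (key x y hlt h) hx
    · exact heq
    · exact absurd (key y x hgt h.symm) hy

/-- A finite measurable partition of the unit interval is, up to a null set and a measure
isomorphism, the partition of a product space by the values of the first coordinate. -/
theorem exists_measurableEquiv_prod_fst_ae_eq [Finite ι] (hP : Measurable P) :
    ∃ e : I ≃ᵐ ι × I, MeasurePreserving e volume ((volume.map P).prod volume) ∧
      (fun x ↦ (e x).1) =ᵐ[volume] P := by
  obtain ⟨A, hA, hA0, hinj⟩ := exists_measurableSet_injOn_fiberwiseCDF hP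
  obtain ⟨C, hC, hCc, hC0⟩ := exists_uncountable_null_set_unitInterval
  have : IsProbabilityMeasure ((volume : Measure I).map P) :=
    Measure.isProbabilityMeasure_map hP.aemeasurable
  have hT := measurePreserving_fiberwiseCDF hP
  obtain ⟨e, he⟩ := hT.exists_measurableEquiv_ae_eq hA hA0 hinj hC hCc hC0
    (C' := Prod.snd ⁻¹' C) (measurable_snd hC)
    (fun h ↦ hCc ((h.image Prod.snd).mono fun x hx ↦ (⟨(P x, x), hx, rfl⟩ : x ∈ Prod.snd '' _)))
    (by rw [measurePreserving_snd.measure_preimage hC.nullMeasurableSet, hC0])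
  refine ⟨e, ⟨e.measurable, by rw [Measure.map_congr he, hT.map_eq]⟩, ?_⟩
  filter_upwards [he] with x hx
  rw [hx]
  rfl

end

/-- For any two finite measurable partitions `P`, `P'` of the unit interval there is
an invertible Lebesgue-measure-preserving transformation `φ` such that `P` and
`φ⁻¹ P'` are independent. -/
theorem exists_automorphism_making_partitions_independent
    {k k' : ℕ} (P : I → Fin k) (P' : I → Fin k')
    (hP : Measurable P) (hP' : Measurable P') :
    ∃ φ : I ≃ᵐ I, MeasurePreserving φ (volume : Measure I) volume ∧
      ∀ (i : Fin k) (j : Fin k'),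
        volume (P ⁻¹' {i} ∩ φ ⁻¹' (P' ⁻¹' {j})) =
          volume (P ⁻¹' {i}) * volume (P' ⁻¹' {j}) := by
  obtain ⟨e, he, heP⟩ := exists_measurableEquiv_prod_fst_ae_eq hP
  obtain ⟨e', he', heP'⟩ := exists_measurableEquiv_prod_fst_ae_eq hP'
  have : IsProbabilityMeasure ((volume : Measure I).map P) :=
    Measure.isProbabilityMeasure_map hP.aemeasurable
  have : IsProbabilityMeasure ((volume : Measure I).map P') :=
    Measure.isProbabilityMeasure_map hP'.aemeasurable
  -- exchange the two label coordinates in `Fin k × (Fin k' × I)`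
  let σ : I ≃ᵐ Fin k × (Fin k' × I) := e.trans ((MeasurableEquiv.refl _).prodCongr e')
  let σ' : I ≃ᵐ Fin k' × (Fin k × I) := e'.trans ((MeasurableEquiv.refl _).prodCongr e)
  let τ : Fin k × (Fin k' × I) ≃ᵐ Fin k' × (Fin k × I) :=
    MeasurableEquiv.prodAssoc.symm.trans
      ((MeasurableEquiv.prodComm.prodCongr (MeasurableEquiv.refl _)).trans
        MeasurableEquiv.prodAssoc)
  have hσ : MeasurePreserving σ volume
      ((volume.map P).prod ((volume.map P').prod volume)) :=
    ((MeasurePreserving.id _).prod he').comp he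
  have hσ' : MeasurePreserving σ' volume
      ((volume.map P').prod ((volume.map P).prod volume)) :=
    ((MeasurePreserving.id _).prod he).comp he'
  have hτ : MeasurePreserving τ ((volume.map P).prod ((volume.map P').prod volume))
      ((volume.map P').prod ((volume.map P).prod volume)) :=
    (measurePreserving_prodAssoc _ _ _).comp
      ((Measure.measurePreserving_swap.prod (MeasurePreserving.id _)).comp
        ((measurePreserving_prodAssoc _ _ _).symm _))
  have hφ : MeasurePreserving ((σ.trans τ).trans σ'.symm) volume volume :=
    (hσ'.symm _).comp (hτ.comp hσ)
  refine ⟨(σ.trans τ).trans σ'.symm, hφ, fun i j ↦ ?_⟩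
  have hfst (x : I) : (e' (((σ.trans τ).trans σ'.symm) x)).1 = (e' (e x).2).1 := by
    have : σ' (((σ.trans τ).trans σ'.symm) x) = τ (σ x) := σ'.apply_symm_apply _
    have h := congrArg Prod.fst this
    exact h
  have hae := hφ.quasiMeasurePreserving.ae heP'
  have hset : (P ⁻¹' {i} ∩ ((σ.trans τ).trans σ'.symm) ⁻¹' (P' ⁻¹' {j}) : Set I)
      =ᵐ[volume] e ⁻¹' ({i} ×ˢ ((fun y ↦ (e' y).1) ⁻¹' {j})) := by
    filter_upwards [heP, hae] with x hx hx'
    refine propext ?_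
    change (P x = i ∧ P' (((σ.trans τ).trans σ'.symm) x) = j) ↔
      ((e x).1 = i ∧ (e' (e x).2).1 = j)
    rw [← hx', hfst, hx]
  have hj : ((fun y ↦ (e' y).1) ⁻¹' {j} : Set I) =ᵐ[volume] P' ⁻¹' {j} := by
    filter_upwards [heP'] with x hx
    refine propext ?_
    change (e' x).1 = j ↔ P' x = j
    rw [hx]
  rw [measure_congr hset, he.measure_preimage_equiv, Measure.prod_prod,
    Measure.map_apply hP (measurableSet_singleton i), measure_congr hj]
end

section
/- Let G be a group, H ⊆ G finite, 𝒞 = {C₁,…,C_k} a partition of H, and σ : ⋃_i C_i × C_i → Aut(I,m) a map satisfying σ(g₁,g₃) = σ(g₂,g₃) ∘ σ(g₁,g₂) whenever g₁,g₂,g₃ lie in a common cell. Then there exists ψ : H × H → Aut(I,m) extending σ, satisfying the full cocycle condition ψ(h₁,h₃) = ψ(h₂,h₃) ∘ ψ(h₁,h₂) for all h₁,h₂,h₃ ∈ H, and such that for any fixed h₀ ∈ H, the partitions ⋁_{h∈C} ψ(h₀,h)⁻¹π of I, as C ranges over 𝒞, are mutually independent with respect to m. -/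
open MeasureTheory Set

/-- The unit interval as a subtype of `ℝ`, with Lebesgue measure. -/
local notation "I" => (Icc (0:ℝ) 1)

/-- The indicator of `[1/2,1]` on the unit interval (the partition `π`). -/
noncomputable def piHalf (t : I) : Bool := decide ((1:ℝ)/2 ≤ (t : ℝ))

section

open Filter ProbabilityTheory Topology

/-- Every s-finite measure on an uncountable standard Borel space has an uncountable null set. -/
theorem exists_measurableSet_null_not_countable {Ω : Type*} [MeasurableSpace Ω]
    [StandardBorelSpace Ω] [Uncountable Ω] (μ : Measure Ω) [SFinite μ] :
    ∃ K, MeasurableSet K ∧ ¬ K.Countable ∧ μ K = 0 := by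
  have hΩ : ¬ Countable Ω := not_countable
  have : Uncountable (Ω × Ω) := Function.Injective.uncountable (f := fun x : Ω => (x, x))
    (fun x y h => congrArg Prod.fst h)
  let b : Ω ≃ᵐ Ω × Ω := PolishSpace.measurableEquivOfNotCountable hΩ
    (not_countable_iff.2 this)
  have hA : ∀ x : Ω, MeasurableSet ((fun ω => (b ω).1) ⁻¹' {x}) := fun x =>
    (measurable_fst.comp b.measurable) (measurableSet_singleton x)
  have hc := Measure.countable_meas_pos_of_disjoint_iUnion (μ := μ) hA
    (fun x y hxy => Disjoint.preimage _ (disjoint_singleton.2 hxy))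
  obtain ⟨x, hx⟩ : ∃ x, x ∉ {x : Ω | 0 < μ ((fun ω => (b ω).1) ⁻¹' {x})} := by
    by_contra! h
    exact hΩ (countable_univ_iff.1 (hc.mono fun x _ => h x))
  refine ⟨_, hA x, fun h => ?_, by simpa using hx⟩
  refine hΩ (countable_univ_iff.1 ?_)
  have := h.preimage (f := fun y : Ω => b.symm (x, y))
    (fun y z hyz => congrArg Prod.snd (b.symm.injective hyz))
  refine this.mono fun y _ => by simp

/-- A measure-preserving map between standard Borel spaces which is injective off a null set
agrees almost everywhere with a measurable equivalence. -/
theorem MeasureTheory.MeasurePreserving.exists_measurableEquiv_ae_eq_s18 {Ω Ω' : Type*}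
    [MeasurableSpace Ω] [StandardBorelSpace Ω] [Uncountable Ω]
    [MeasurableSpace Ω'] [StandardBorelSpace Ω'] [Uncountable Ω']
    {μ : Measure Ω} [SFinite μ] {ν : Measure Ω'} [SFinite ν] {T : Ω → Ω'}
    (hT : MeasurePreserving T μ ν) {N : Set Ω} (hN : MeasurableSet N) (hμN : μ N = 0)
    (hinj : InjOn T Nᶜ) : ∃ e : Ω ≃ᵐ Ω', e =ᵐ[μ] T := by
  classical
  obtain ⟨K, hK, hKc, hμK⟩ := exists_measurableSet_null_not_countable μ
  obtain ⟨L, hL, hLc, hνL⟩ := exists_measurableSet_null_not_countable ν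
  set X : Set Ω := (N ∪ K ∪ T ⁻¹' L)ᶜ with hX
  have hXm : MeasurableSet X := ((hN.union hK).union (hT.measurable hL)).compl
  have hXinj : InjOn T X := hinj.mono
    (compl_subset_compl.2 (subset_union_left.trans subset_union_left))
  have : StandardBorelSpace X := hXm.standardBorel
  have hemb : MeasurableEmbedding (X.domRestrict T) :=
    (hT.measurable.comp measurable_subtype_coe).measurableEmbedding (injOn_iff_injective.1 hXinj)
  set Y : Set Ω' := range (X.domRestrict T)
  have hYm : MeasurableSet Y := hemb.measurableSet_range
  have : StandardBorelSpace (Xᶜ : Set Ω) := hXm.compl.standardBorel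
  have : StandardBorelSpace (Yᶜ : Set Ω') := hYm.compl.standardBorel
  have hXc : ¬ Countable (Xᶜ : Set Ω) := fun h => hKc <|
    (show (Xᶜ).Countable from h).mono (by
      rw [hX, compl_compl]; exact subset_union_right.trans subset_union_left)
  have hYc : ¬ Countable (Yᶜ : Set Ω') := fun h => hLc <|
    (show (Yᶜ).Countable from h).mono (by
      rintro y hy ⟨x, rfl⟩
      exact x.2 (Or.inr hy))
  let e₁ := hemb.equivRange
  let e₂ : (Xᶜ : Set Ω) ≃ᵐ (Yᶜ : Set Ω') :=
    PolishSpace.measurableEquivOfNotCountable hXc hYc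
  refine ⟨(MeasurableEquiv.sumCompl hXm).symm.trans
    ((MeasurableEquiv.sumCongr e₁ e₂).trans (MeasurableEquiv.sumCompl hYm)), ?_⟩
  have hXae : ∀ᵐ x ∂μ, x ∈ X := by
    rw [ae_iff]
    change μ Xᶜ = 0
    rw [hX, compl_compl, measure_union_null_iff, measure_union_null_iff]
    exact ⟨⟨hμN, hμK⟩, (hT.measure_preimage hL.nullMeasurableSet).trans hνL⟩
  filter_upwards [hXae] with x hx
  have hx' : (MeasurableEquiv.sumCompl hXm).symm x = Sum.inl ⟨x, hx⟩ :=
    (MeasurableEquiv.symm_apply_eq _).2 rfl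
  simp only [MeasurableEquiv.trans_apply, hx']
  exact congrArg Subtype.val (hemb.equivRange_apply ⟨x, hx⟩)

theorem continuous_cdf (ν : Measure ℝ) [IsProbabilityMeasure ν] [NullSingletonClass ν] :
    Continuous (cdf ν) := by
  refine continuous_iff_continuousAt.2 fun x => ?_
  rw [(monotone_cdf ν).continuousAt_iff_leftLim_eq_rightLim, StieltjesFunction.rightLim_eq]
  have h := (cdf ν).measure_singleton x
  rw [measure_cdf, measure_singleton, eq_comm, ENNReal.ofReal_eq_zero] at h
  exact le_antisymm ((monotone_cdf ν).leftLim_le le_rfl) (by linarith)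

/-- The distribution function of an atomless probability measure pushes it to the uniform law. -/
theorem measurePreserving_cdf (ν : Measure ℝ) [IsProbabilityMeasure ν] [NullSingletonClass ν] :
    MeasurePreserving (fun x => (⟨cdf ν x, cdf_nonneg ν x, cdf_le_one ν x⟩ : Icc (0 : ℝ) 1))
      ν volume := by
  have hcont := continuous_cdf ν
  have hmeas : Measurable (fun x => (⟨cdf ν x, cdf_nonneg ν x, cdf_le_one ν x⟩ : Icc (0 : ℝ) 1)) :=
    hcont.measurable.subtype_mk
  have hivt : ∀ u ∈ Ioo (0 : ℝ) 1, ∃ x, cdf ν x = u := fun u hu =>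
    mem_range_of_exists_le_of_exists_ge hcont
      (((tendsto_cdf_atBot ν).eventually_le_const hu.1).exists)
      (((tendsto_cdf_atTop ν).eventually_const_le hu.2).exists)
  refine ⟨hmeas, ?_⟩
  have := Measure.isProbabilityMeasure_map (μ := ν) hmeas.aemeasurable
  refine Measure.ext_of_Iic _ _ fun u => ?_
  rw [Measure.map_apply hmeas measurableSet_Iic, unitInterval.volume_Iic]
  change ν {x | cdf ν x ≤ u} = _
  refine le_antisymm ?_ ?_
  · rcases u.2.2.eq_or_lt with h1 | h1
    · simpa [h1] using prob_le_one
    have hlim : Tendsto ENNReal.ofReal (𝓝[>] (u : ℝ)) (𝓝 (ENNReal.ofReal u)) :=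
      ENNReal.continuous_ofReal.continuousWithinAt
    refine ge_of_tendsto hlim ?_
    filter_upwards [Ioo_mem_nhdsGT h1] with v hv
    obtain ⟨x, rfl⟩ := hivt v ⟨u.2.1.trans_lt hv.1, hv.2⟩
    rw [ofReal_cdf]
    exact measure_mono fun y hy => ((monotone_cdf ν).reflect_lt (lt_of_le_of_lt hy hv.1)).le
  · rcases u.2.1.eq_or_lt with h0 | h0
    · simp [← h0]
    rcases u.2.2.eq_or_lt with h1 | h1
    · have : {x | cdf ν x ≤ u} = univ := by
        ext x; simp [h1, cdf_le_one]
      rw [this, h1]; simp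
    obtain ⟨x, hx⟩ := hivt u ⟨h0, h1⟩
    rw [← hx, ofReal_cdf]
    exact measure_mono fun y hy => monotone_cdf ν hy


/-- A countably valued random variable on an atomless standard Borel space becomes, after a
measurable identification with the unit interval, the step function determined by its
distribution function. -/
theorem exists_measurableEquiv_unitInterval_sublevel {Ω : Type*} [MeasurableSpace Ω]
    [StandardBorelSpace Ω] (μ : Measure Ω) [IsProbabilityMeasure μ] [NullSingletonClass μ]
    {f : Ω → ℕ} (hf : Measurable f) :
    ∃ e : Ω ≃ᵐ Icc (0 : ℝ) 1, MeasurePreserving e μ volume ∧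
      ∀ᵐ ω ∂μ, ∀ n, f ω ≤ n ↔ (e ω : ℝ) ≤ μ.real {ω | f ω ≤ n} := by
  have hΩ : ¬ Countable Ω := fun h => by
    simpa using (countable_univ (α := Ω)).measure_zero μ
  have : Uncountable Ω := not_countable_iff.1 hΩ
  have hI : ¬ Countable (Icc (0 : ℝ) 1) := fun h => by
    simpa using (countable_univ (α := Icc (0 : ℝ) 1)).measure_zero volume
  have : Uncountable (Icc (0 : ℝ) 1) := not_countable_iff.1 hI
  let b : Ω ≃ᵐ Icc (0 : ℝ) 1 := PolishSpace.measurableEquivOfNotCountable hΩ hI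
  let S : Ω → ℝ := fun ω => f ω + b ω / 2
  have hS : Measurable S := by
    have h₁ : Measurable fun ω => (f ω : ℝ) := measurable_from_nat.comp hf
    have h₂ : Measurable fun ω => (b ω : ℝ) := measurable_subtype_coe.comp b.measurable
    exact h₁.add (h₂.div_const 2)
  have hS_le : ∀ ω (n : ℕ), S ω ≤ n + 1 / 2 ↔ f ω ≤ n := by
    intro ω n
    have h₀ := (b ω).2.1
    have h₁ := (b ω).2.2
    constructor
    · intro h
      have : (f ω : ℝ) < n + 1 := by simp only [S] at h; linarith
      exact Nat.lt_succ_iff.1 (by exact_mod_cast this)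
    · intro h
      have : (f ω : ℝ) ≤ n := by exact_mod_cast h
      simp only [S]; linarith
  have hSinj : Function.Injective S := by
    intro ω ω' h
    have hff : f ω = f ω' := le_antisymm
      ((hS_le _ _).1 (h ▸ (hS_le _ _).2 le_rfl)) ((hS_le _ _).1 (h ▸ (hS_le _ _).2 le_rfl))
    simp only [S, hff, add_right_inj] at h
    exact b.injective (Subtype.ext (by linarith))
  let ν := μ.map S
  have : IsProbabilityMeasure ν := Measure.isProbabilityMeasure_map hS.aemeasurable
  have : NullSingletonClass ν := ⟨fun x => by
    rw [Measure.map_apply hS (measurableSet_singleton x)]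
    exact (subsingleton_singleton.preimage hSinj).measure_zero μ⟩
  have hU := measurePreserving_cdf ν
  set U : ℝ → Icc (0 : ℝ) 1 := fun x => ⟨cdf ν x, cdf_nonneg ν x, cdf_le_one ν x⟩
  have hUmono : Monotone U := fun x y h => monotone_cdf ν h
  have hT : MeasurePreserving (U ∘ S) μ volume := hU.comp ⟨hS, rfl⟩
  let D : Set (Icc (0 : ℝ) 1) := range fun q : ℚ => U q
  have hD : D.Countable := countable_range _
  have hlt : ∀ x y, x < y → U x = U y → U x ∈ D := by
    intro x y hxy h
    obtain ⟨q, hxq, hqy⟩ := exists_rat_btwn hxy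
    exact ⟨q, le_antisymm ((hUmono hqy.le).trans h.ge) (hUmono hxq.le)⟩
  have hinj : InjOn (U ∘ S) ((U ∘ S) ⁻¹' D)ᶜ := by
    intro ω hω ω' hω' h
    refine hSinj ?_
    rcases lt_trichotomy (S ω) (S ω') with h' | h' | h'
    · exact absurd (hlt _ _ h' h) hω
    · exact h'
    · exact absurd (hlt _ _ h' h.symm) hω'
  obtain ⟨e, he⟩ := hT.exists_measurableEquiv_ae_eq_s18 (hT.measurable hD.measurableSet)
    ((hT.measure_preimage hD.measurableSet.nullMeasurableSet).trans (hD.measure_zero _)) hinj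
  refine ⟨e, ⟨e.measurable, (Measure.map_congr he).trans hT.map_eq⟩, ?_⟩
  rw [ae_all_iff]
  intro n
  have hset : {ω | f ω ≤ n} = S ⁻¹' Iic ((n : ℝ) + 1 / 2) := by
    ext ω; exact (hS_le ω n).symm
  have hreal : μ.real {ω | f ω ≤ n} = cdf ν (n + 1 / 2) := by
    rw [cdf_eq_real, map_measureReal_apply hS measurableSet_Iic, hset]
  have hsub : {ω | f ω ≤ n} ⊆ (U ∘ S) ⁻¹' Iic (U (n + 1 / 2)) := fun ω hω =>
    hUmono ((hS_le ω n).2 hω)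
  have hae : {ω | f ω ≤ n} =ᵐ[μ] (U ∘ S) ⁻¹' Iic (U (n + 1 / 2)) := by
    refine ae_eq_of_subset_of_measure_ge hsub ?_
      (hf measurableSet_Iic).nullMeasurableSet (measure_ne_top _ _)
    rw [hT.measure_preimage measurableSet_Iic.nullMeasurableSet, unitInterval.volume_Iic]
    change ENNReal.ofReal (cdf ν (n + 1 / 2)) ≤ _
    rw [← hreal, ofReal_measureReal]
  filter_upwards [he, hae.mem_iff] with ω h₁ h₂
  rw [h₁, hreal]
  exact h₂

/-- Two countably valued random variables with the same law on atomless standard Borel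
probability spaces are almost everywhere conjugate. -/
theorem exists_measurePreserving_comp_ae_eq {Ω Ω' F : Type*} [MeasurableSpace Ω]
    [StandardBorelSpace Ω] [MeasurableSpace Ω'] [StandardBorelSpace Ω'] [Countable F]
    [MeasurableSpace F] [MeasurableSingletonClass F] {μ : Measure Ω} [IsProbabilityMeasure μ]
    [NullSingletonClass μ] {ν : Measure Ω'} [IsProbabilityMeasure ν] [NullSingletonClass ν]
    {f : Ω → F} {g : Ω' → F} (hf : Measurable f) (hg : Measurable g)
    (hfg : μ.map f = ν.map g) :
    ∃ θ : Ω ≃ᵐ Ω', MeasurePreserving θ μ ν ∧ ∀ᵐ ω ∂μ, g (θ ω) = f ω := by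
  obtain ⟨c, hc⟩ := exists_injective_nat F
  have hcm : Measurable c := measurable_of_countable c
  obtain ⟨e, he, hef⟩ := exists_measurableEquiv_unitInterval_sublevel μ (hcm.comp hf)
  obtain ⟨d, hd, hdg⟩ := exists_measurableEquiv_unitInterval_sublevel ν (hcm.comp hg)
  have hθ : MeasurePreserving (e.trans d.symm) μ ν := (hd.symm d).comp he
  refine ⟨e.trans d.symm, hθ, ?_⟩
  have hlaw : ∀ n, μ.real {ω | (c ∘ f) ω ≤ n} = ν.real {ω | (c ∘ g) ω ≤ n} := fun n => by
    have := congrArg (fun m => m.real {x | c x ≤ n}) hfg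
    rwa [map_measureReal_apply hf (Set.to_countable _).measurableSet,
      map_measureReal_apply hg (Set.to_countable _).measurableSet] at this
  filter_upwards [hef, hθ.quasiMeasurePreserving.ae hdg] with ω h₁ h₂
  have key : ∀ n, c (f ω) ≤ n ↔ c (g (e.trans d.symm ω)) ≤ n := fun n => by
    have h₂' := h₂ n
    rw [MeasurableEquiv.trans_apply, MeasurableEquiv.apply_symm_apply, ← hlaw] at h₂'
    exact (h₁ n).trans h₂'.symm
  exact hc (le_antisymm ((key _).1 le_rfl) ((key _).2 le_rfl))

theorem measurable_piHalf : Measurable piHalf :=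
  measurable_to_bool <| by
    have : piHalf ⁻¹' {true} = {t : I | (1 : ℝ) / 2 ≤ t} := by ext t; simp [piHalf]
    rw [this]
    exact measurableSet_le measurable_const measurable_subtype_coe

end

/-- Extension of a cellwise cocycle to a fully independent cocycle on a finite
pattern: given a finite `H ⊆ G` partitioned into cells `C 1, …, C k` and a
measure-preserving cocycle `σ` defined within each cell, there is a
measure-preserving cocycle `ψ` on all of `H × H` extending `σ` such that, for any
base point `h₀ ∈ H`, the join partitions `⋁_{h ∈ C} ψ(h₀,h)⁻¹ π` indexed by the
cells `C` are mutually independent. -/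
theorem exists_independent_cocycle_extension {G : Type*} [Group G] [DecidableEq G]
    (H : Finset G) (k : ℕ) (C : Fin k → Finset G)
    (hne : ∀ i, (C i).Nonempty)
    (hdisj : ∀ i j, i ≠ j → Disjoint (C i) (C j))
    (hcover : H = Finset.univ.biUnion C)
    (σ : G → G → (I ≃ᵐ I))
    (hσmp : ∀ i, ∀ g₁ ∈ C i, ∀ g₂ ∈ C i,
      MeasurePreserving (σ g₁ g₂) (volume : Measure I) volume)
    (hσcoc : ∀ i, ∀ g₁ ∈ C i, ∀ g₂ ∈ C i, ∀ g₃ ∈ C i, ∀ t : I,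
      σ g₁ g₃ t = σ g₂ g₃ (σ g₁ g₂ t)) :
    ∃ ψ : G → G → (I ≃ᵐ I),
      (∀ h₁ ∈ H, ∀ h₂ ∈ H,
        MeasurePreserving (ψ h₁ h₂) (volume : Measure I) volume) ∧
      (∀ i, ∀ g₁ ∈ C i, ∀ g₂ ∈ C i, ψ g₁ g₂ = σ g₁ g₂) ∧
      (∀ h₁ ∈ H, ∀ h₂ ∈ H, ∀ h₃ ∈ H, ∀ t : I,
        ψ h₁ h₃ t = ψ h₂ h₃ (ψ h₁ h₂ t)) ∧
      (∀ h₀ ∈ H, ∀ w : G → Bool,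
        volume (⋂ i, {t : I | ∀ h ∈ C i, piHalf (ψ h₀ h t) = w h}) =
          ∏ i, volume {t : I | ∀ h ∈ C i, piHalf (ψ h₀ h t) = w h}) := by
  rcases isEmpty_or_nonempty (Fin k) with hk | ⟨⟨i₀⟩⟩
  · have hH : H = ∅ := by simp [hcover]
    subst hH
    exact ⟨σ, by simp, fun i => isEmptyElim i, by simp, by simp⟩
  have hidx : ∀ h, ∃ i, h ∈ H → h ∈ C i := fun h => by
    by_cases hh : h ∈ H
    · obtain ⟨i, -, hi⟩ := Finset.mem_biUnion.1 (hcover ▸ hh)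
      exact ⟨i, fun _ => hi⟩
    · exact ⟨i₀, fun h' => absurd h' hh⟩
  choose idx hidx using hidx
  choose c hc using hne
  have hCH : ∀ i, ∀ h ∈ C i, h ∈ H := fun i h hh =>
    hcover ▸ Finset.mem_biUnion.2 ⟨i, Finset.mem_univ i, hh⟩
  have idx_eq : ∀ i, ∀ h ∈ C i, idx h = i := fun i h hh => by
    by_contra hne
    exact Finset.disjoint_left.1 (hdisj _ _ hne) (hidx h (hCH i h hh)) hh
  have hid : ∀ i, ∀ g ∈ C i, ∀ t, σ g g t = t := fun i g hg t =>
    (σ g g).injective (hσcoc i g hg g hg g hg t).symm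
  let f : ∀ i, I → ({h // h ∈ C i} → Bool) := fun i s h => piHalf (σ (c i) h s)
  have hf : ∀ i, Measurable (f i) := fun i =>
    measurable_pi_lambda _ fun h => measurable_piHalf.comp (σ (c i) h).measurable
  have heval : ∀ i, MeasurePreserving (Function.eval i : (Fin k → I) → I) volume volume :=
    fun i => measurePreserving_eval (fun _ => (volume : Measure I)) i
  have hθ : ∀ i, ∃ θ : (Fin k → I) ≃ᵐ I, MeasurePreserving θ volume volume ∧
      ∀ᵐ ω, f i (θ ω) = f i (ω i) := fun i => by
    have : Nonempty (Fin k) := ⟨i⟩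
    refine exists_measurePreserving_comp_ae_eq ((hf i).comp (measurable_pi_apply i)) (hf i) ?_
    exact (Measure.map_map (hf i) (measurable_pi_apply i)).symm.trans
      (congrArg _ (heval i).map_eq)
  choose θ hθ hθf using hθ
  let ψ : G → G → (I ≃ᵐ I) := fun g h => (σ g (c (idx g))).trans
    ((θ (idx g)).symm.trans ((θ (idx h)).trans (σ (c (idx h)) h)))
  have hψ : ∀ g h t, ψ g h t =
      σ (c (idx h)) h (θ (idx h) ((θ (idx g)).symm (σ g (c (idx g)) t))) := fun _ _ _ => rfl
  have hbase : ∀ h ∈ H, MeasurePreserving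
      (fun t => (θ (idx h)).symm (σ h (c (idx h)) t)) volume volume := fun h hh =>
    ((hθ (idx h)).symm _).comp (hσmp _ h (hidx h hh) _ (hc _))
  refine ⟨ψ, fun g hg h hh => ?_, fun i g hg h hh => ?_, fun g hg h hh l hl t => ?_,
    fun h₀ hh₀ w => ?_⟩
  · exact (hσmp _ _ (hc _) h (hidx h hh)).comp ((hθ (idx h)).comp (hbase g hg))
  · ext1
    funext t
    rw [hψ, idx_eq i g hg, idx_eq i h hh, MeasurableEquiv.apply_symm_apply]
    exact (hσcoc i g hg _ (hc i) h hh t).symm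
  · rw [hψ h l, hψ g h, ← hσcoc _ _ (hc _) h (hidx h hh) _ (hc _), hid _ _ (hc _),
      MeasurableEquiv.symm_apply_apply, hψ g l]
  · let A : Fin k → Set I := fun i => f i ⁻¹' {fun h : {h // h ∈ C i} => w h}
    have hA : ∀ i, MeasurableSet (A i) := fun i => hf i (measurableSet_singleton _)
    have hset : ∀ i, {t : I | ∀ h ∈ C i, piHalf (ψ h₀ h t) = w h} =
        (fun t => (θ (idx h₀)).symm (σ h₀ (c (idx h₀)) t)) ⁻¹' (θ i ⁻¹' A i) := fun i => by
      ext t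
      simp only [A, f, mem_ofPred_eq, mem_preimage, mem_singleton_iff, funext_iff, Subtype.forall]
      refine forall₂_congr fun h hh => ?_
      rw [hψ, idx_eq i h hh]
    have hmeas : ∀ i, MeasurableSet (θ i ⁻¹' A i) := fun i => (θ i).measurable (hA i)
    simp only [hset]
    rw [← preimage_iInter, (hbase h₀ hh₀).measure_preimage
      (MeasurableSet.iInter hmeas).nullMeasurableSet]
    have hinter : (⋂ i, θ i ⁻¹' A i) =ᵐ[volume] (univ.pi A : Set (Fin k → I)) := by
      filter_upwards [ae_all_iff.2 hθf] with ω hω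
      refine propext ?_
      change ω ∈ (⋂ i, θ i ⁻¹' A i) ↔ ω ∈ univ.pi A
      simp only [mem_iInter, mem_univ_pi, mem_preimage, A, hω]
    rw [measure_congr hinter, volume_pi_pi]
    refine Finset.prod_congr rfl fun i _ => ?_
    rw [(hbase h₀ hh₀).measure_preimage (hmeas i).nullMeasurableSet,
      (hθ i).measure_preimage (hA i).nullMeasurableSet]
end
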